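/- (Special McKay criterion, Theorem A.) For every integer i with 1 ≤ i ≤ r−1, the map Φ_i is surjective (i.e. the irreducible representation ρ_i of the cyclic group C_{r,a} is special) if and only if every monomial in the G-basis B(G) of weight congruent to i modulo r belongs to the L-space L(G). -/

import Mathlib

/-- The `G`-basis `B(G)` for the cyclic group `C_{r,a}`: monomials `x^m y^n`
(identified with pairs `(m,n) ∈ ℕ × ℕ`) that are divisible by no nonconstant
`G`-invariant monomial, where `x^p y^q` is `G`-invariant iff `r ∣ p + a*q`. -/
def BG (r a : ℕ) : Set (ℕ × ℕ) :=
  {mn | ∀ p q : ℕ, (p, q) ≠ (0, 0) → r ∣ p + a * q → ¬(p ≤ mn.1 ∧ q ≤ mn.2)}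

/-- The `L`-space `L(G)`: the monomials `x^k` and `y^k` with `0 ≤ k ≤ r-1`. -/
def LG (r : ℕ) : Set (ℕ × ℕ) :=
  {mn | (mn.2 = 0 ∧ mn.1 ≤ r - 1) ∨ (mn.1 = 0 ∧ mn.2 ≤ r - 1)}

open MvPolynomial in
/-- The `ℂ`-algebra automorphism `g` of `ℂ[x,y]` with `g x = ε • x`, `g y = ε^a • y`. -/
noncomputable def gAut (ε : ℂ) (a : ℕ) :
    MvPolynomial (Fin 2) ℂ →ₐ[ℂ] MvPolynomial (Fin 2) ℂ :=
  aeval (fun j : Fin 2 => if j = 0 then C ε * X 0 else C (ε ^ a) * X 1)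

/-- The semi-invariants of weight `i`: `S_i = {f : g f = ε^i • f}`. -/
def Sset (ε : ℂ) (a : ℕ) (i : ℤ) : Set (MvPolynomial (Fin 2) ℂ) :=
  {f | gAut ε a f = (ε ^ i) • f}

/-- Surjectivity of the multiplication map `Φ_i : S_{-(a+1)} × S_i → S_{i-(a+1)}`:
`S_{i-(a+1)}` equals the `ℂ`-linear span of the products `f * h`. -/
def PhiSurj (ε : ℂ) (a : ℕ) (i : ℤ) : Prop :=
  Sset ε a (i - (a + 1)) =
    ↑(Submodule.span ℂ
      {p : MvPolynomial (Fin 2) ℂ |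
        ∃ f ∈ Sset ε a (-(a + 1)), ∃ h ∈ Sset ε a i, p = f * h})

theorem IsPrimitiveRoot.pow_eq_zpow_iff_modEq {r : ℕ} {ε : ℂ} (hε : IsPrimitiveRoot ε r)
    (hr : r ≠ 0) (n : ℕ) (j : ℤ) : ε ^ n = ε ^ j ↔ (n : ℤ) ≡ j [ZMOD r] := by
  have h0 : ε ≠ 0 := hε.ne_zero hr
  rw [← zpow_natCast, Int.modEq_comm, Int.modEq_iff_dvd, ← hε.zpow_eq_one_iff_dvd,
    zpow_sub₀ h0, div_eq_one_iff_eq (zpow_ne_zero _ h0)]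

/-- The weight of the monomial with exponent vector `d`. -/
def weight (a : ℕ) (d : Fin 2 →₀ ℕ) : ℕ := d 0 + a * d 1

theorem weight_add (a : ℕ) (d e : Fin 2 →₀ ℕ) : weight a (d + e) = weight a d + weight a e := by
  simp only [weight, Finsupp.add_apply]
  ring

open MvPolynomial in
theorem gAut_monomial (ε : ℂ) (a : ℕ) (d : Fin 2 →₀ ℕ) (c : ℂ) :
    gAut ε a (monomial d c) = monomial d (ε ^ weight a d * c) := by
  rw [gAut, aeval_monomial, Finsupp.prod_fintype _ _ (fun _ => pow_zero _), Fin.prod_univ_two,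
    monomial_eq, Finsupp.prod_fintype _ _ (fun _ => pow_zero _), Fin.prod_univ_two]
  simp only [weight, algebraMap_eq, if_true, one_ne_zero, if_false, mul_pow, map_mul, map_pow,
    pow_add, pow_mul]
  ring

open MvPolynomial in
theorem coeff_gAut (ε : ℂ) (a : ℕ) (d : Fin 2 →₀ ℕ) (f : MvPolynomial (Fin 2) ℂ) :
    coeff d (gAut ε a f) = ε ^ weight a d * coeff d f := by
  classical
  induction f using MvPolynomial.induction_on' with
  | monomial e c =>
    rw [gAut_monomial, coeff_monomial, coeff_monomial]
    split_ifs with h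
    · rw [h]
    · rw [mul_zero]
  | add p q hp hq => rw [map_add, coeff_add, hp, hq, coeff_add, mul_add]

open MvPolynomial in
theorem mem_Sset_iff {r : ℕ} {ε : ℂ} (hε : IsPrimitiveRoot ε r) (hr : r ≠ 0) (a : ℕ) (j : ℤ)
    (f : MvPolynomial (Fin 2) ℂ) :
    f ∈ Sset ε a j ↔ ∀ d ∈ f.support, (weight a d : ℤ) ≡ j [ZMOD r] := by
  rw [Sset, Set.mem_ofPred_eq, MvPolynomial.ext_iff]
  refine forall_congr' fun d => ?_
  rw [coeff_gAut, coeff_smul, smul_eq_mul, mul_eq_mul_right_iff, mem_support_iff,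
    hε.pow_eq_zpow_iff_modEq hr]
  tauto

open MvPolynomial in
/-- `Φ_i` is surjective iff each monomial of weight `i - (a + 1)` is divisible by one of
weight `i`. -/
theorem phiSurj_iff {r : ℕ} {ε : ℂ} (hε : IsPrimitiveRoot ε r) (hr : r ≠ 0) (a : ℕ) (i : ℤ) :
    PhiSurj ε a i ↔ ∀ d : Fin 2 →₀ ℕ, (weight a d : ℤ) ≡ i - (a + 1) [ZMOD r] →
      ∃ e ≤ d, (weight a e : ℤ) ≡ i [ZMOD r] := by
  classical
  have hsupp : ∀ {d : Fin 2 →₀ ℕ} {c : ℂ} {j : ℤ}, (weight a d : ℤ) ≡ j [ZMOD r] →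
      monomial d c ∈ Sset ε a j := fun {d c j} h => by
    rw [mem_Sset_iff hε hr]
    intro e he
    rwa [Finset.mem_singleton.1 (support_monomial_subset he)]
  constructor
  · intro h d hd
    have hmem : monomial d (1 : ℂ) ∈ Sset ε a (i - (a + 1)) := hsupp hd
    rw [h, SetLike.mem_coe] at hmem
    have key : ∀ p ∈ Submodule.span ℂ {p : MvPolynomial (Fin 2) ℂ |
          ∃ f ∈ Sset ε a (-(a + 1)), ∃ h ∈ Sset ε a i, p = f * h},
        ∀ e ∈ p.support, ∃ e' ≤ e, (weight a e' : ℤ) ≡ i [ZMOD r] := by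
      intro p hp
      induction hp using Submodule.span_induction with
      | mem p hp =>
        obtain ⟨f, -, g, hg, rfl⟩ := hp
        intro e he
        obtain ⟨u, -, v, hv, rfl⟩ := Finset.mem_add.1 (support_mul f g he)
        exact ⟨v, le_add_self, (mem_Sset_iff hε hr a i g).1 hg v hv⟩
      | zero => simp
      | add p q _ _ hp hq =>
        intro e he
        rcases Finset.mem_union.1 (support_add he) with h | h
        exacts [hp e h, hq e h]
      | smul c p _ hp => exact fun e he => hp e (support_smul he)
    exact key _ hmem d (by simp [support_monomial])
  · intro h
    refine Set.Subset.antisymm (fun f hf => ?_) fun f hf => ?_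
    · rw [f.as_sum]
      refine Submodule.sum_mem _ fun d hd => Submodule.subset_span ?_
      have hwd := (mem_Sset_iff hε hr a _ f).1 hf d hd
      obtain ⟨e, hle, he⟩ := h d hwd
      refine ⟨monomial (d - e) (coeff d f), hsupp ?_, monomial e 1, hsupp he, ?_⟩
      · have hsum := weight_add a (d - e) e
        rw [tsub_add_cancel_of_le hle] at hsum
        rw [hsum, Nat.cast_add] at hwd
        simpa [sub_eq_add_neg] using hwd.sub he
      · rw [monomial_mul, mul_one, tsub_add_cancel_of_le hle]
    · rw [SetLike.mem_coe] at hf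
      rw [Sset, Set.mem_ofPred_eq]
      induction hf using Submodule.span_induction with
      | mem p hp =>
        obtain ⟨f, hf, g, hg, rfl⟩ := hp
        rw [Sset, Set.mem_ofPred_eq] at hf hg
        rw [map_mul, hf, hg, smul_mul_smul_comm, ← zpow_add₀ (hε.ne_zero hr)]
        congr 2
        ring
      | zero => simp
      | add p q _ _ hp hq => rw [map_add, hp, hq, smul_add]
      | smul c p _ hp => rw [map_smul, hp, smul_comm]

theorem exists_mul_modEq {r a : ℕ} (hr : 0 < r) (h : Nat.Coprime a r) (i : ℤ) :
    ∃ k < r, (a * k : ℤ) ≡ i [ZMOD r] := by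
  obtain ⟨k, hk⟩ := Int.mod_coprime h
  have hr' : (0 : ℤ) < r := by exact_mod_cast hr
  have hnn := Int.emod_nonneg (k * i) hr'.ne'
  refine ⟨((k * i) % r).toNat, ?_, ?_⟩
  · have := Int.emod_lt_of_pos (k * i) hr'
    omega
  · rw [Int.toNat_of_nonneg hnn]
    calc (a * ((k * i) % r) : ℤ) ≡ a * (k * i) [ZMOD r] := (Int.mod_modEq _ _).mul_left _
      _ = a * k * i := by ring
      _ ≡ 1 * i [ZMOD r] := hk.mul_right _
      _ = i := one_mul i

theorem exists_weight_modEq_iff {r a i : ℕ} (hgcd : Nat.Coprime a r) (hi : i < r) :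
    (∀ m n : ℕ, (m + a * n : ℤ) ≡ i - (a + 1) [ZMOD r] →
      ∃ u ≤ m, ∃ v ≤ n, (u + a * v : ℤ) ≡ i [ZMOD r]) ↔
    ∀ mn ∈ BG r a, ((mn.1 + a * mn.2 : ℕ) : ℤ) ≡ i [ZMOD r] → mn ∈ LG r := by
  have hr : 0 < r := by omega
  constructor
  · rintro h ⟨m, n⟩ hB hw
    by_contra hL
    have hm : m < r := by
      by_contra! hm
      exact hB r 0 (by simp [hr.ne']) (by simp) ⟨hm, Nat.zero_le _⟩
    have hn : n < r := by
      by_contra! hn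
      exact hB 0 r (by simp [hr.ne']) (by simp) ⟨Nat.zero_le _, hn⟩
    simp only [LG, Set.mem_ofPred_eq] at hL
    obtain ⟨m, rfl⟩ : ∃ k, m = k + 1 := ⟨m - 1, by omega⟩
    obtain ⟨n, rfl⟩ : ∃ k, n = k + 1 := ⟨n - 1, by omega⟩
    push_cast at hw
    obtain ⟨u, hu, v, hv, huv⟩ := h m n (by
      convert hw.sub_right (a + 1 : ℤ) using 1
      ring)
    refine hB (m + 1 - u) (n + 1 - v) ?_ ?_ ⟨by omega, by omega⟩
    · rw [Ne, Prod.mk.injEq]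
      omega
    · have hd := (huv.trans hw.symm).dvd
      rw [← Int.natCast_dvd_natCast]
      convert hd using 1
      push_cast [Nat.cast_sub (show u ≤ m + 1 by omega), Nat.cast_sub (show v ≤ n + 1 by omega)]
      ring
  · intro h m n hw
    have hw' : ((m + 1 + a * (n + 1) : ℕ) : ℤ) ≡ i [ZMOD r] := by
      convert hw.add_right (a + 1 : ℤ) using 1
      · push_cast
        ring
      · ring
    by_cases hB : (m + 1, n + 1) ∈ BG r a
    · have := h _ hB hw'
      simp [LG] at this
    · simp only [BG, Set.mem_ofPred_eq] at hB
      push Not at hB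
      obtain ⟨p, q, hpq, hdvd, hp, hq⟩ := hB
      rcases Nat.eq_zero_or_pos p with rfl | hp0
      · have hrq : r ∣ q := hgcd.symm.dvd_of_dvd_mul_left (by simpa using hdvd)
        have hq0 : 0 < q := Nat.pos_of_ne_zero fun hq0 => hpq (by rw [hq0])
        have := Nat.le_of_dvd hq0 hrq
        obtain ⟨k, hk, hki⟩ := exists_mul_modEq hr hgcd i
        exact ⟨0, Nat.zero_le _, k, by omega, by simpa using hki⟩
      rcases Nat.eq_zero_or_pos q with rfl | hq0
      · have := Nat.le_of_dvd hp0 (by simpa using hdvd)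
        exact ⟨i, by omega, 0, Nat.zero_le _, by simp⟩
      · refine ⟨m + 1 - p, by omega, n + 1 - q, by omega, ?_⟩
        have hz : ((p + a * q : ℕ) : ℤ) ≡ 0 [ZMOD r] :=
          Int.modEq_zero_iff_dvd.2 (Int.natCast_dvd_natCast.2 hdvd)
        convert hw'.sub hz using 1
        · push_cast [Nat.cast_sub hp, Nat.cast_sub hq]
          ring
        · ring

/-- Special McKay criterion, Theorem A: for `1 ≤ i ≤ r-1`, the map
`Φ_i` is surjective iff every monomial in `B(G)` of weight `≡ i (mod r)` lies in
`L(G)`. -/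
theorem stmt_9 (r a : ℕ) (hr : 2 ≤ r) (ha1 : 1 ≤ a) (ha2 : a ≤ r - 1)
    (hgcd : Nat.Coprime a r) (ε : ℂ) (hε : IsPrimitiveRoot ε r)
    (i : ℕ) (hi1 : 1 ≤ i) (hi2 : i ≤ r - 1) :
    PhiSurj ε a (i : ℤ) ↔
      ∀ mn ∈ BG r a,
        Int.ModEq (r : ℤ) ((mn.1 + a * mn.2 : ℕ) : ℤ) (i : ℤ) → mn ∈ LG r := by
  rw [phiSurj_iff hε (by omega), ← exists_weight_modEq_iff hgcd (by omega)]
  constructor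
  · intro h m n hmn
    obtain ⟨e, hle, he⟩ := h (Finsupp.single 0 m + Finsupp.single 1 n)
      (by simpa [weight] using hmn)
    exact ⟨e 0, by simpa using hle 0, e 1, by simpa using hle 1, by simpa [weight] using he⟩
  · intro h d hd
    obtain ⟨u, hu, v, hv, huv⟩ := h (d 0) (d 1) (by simpa [weight] using hd)
    refine ⟨Finsupp.single 0 u + Finsupp.single 1 v, fun j => ?_, by simpa [weight] using huv⟩
    fin_cases j
    · simpa using hu
    · simpa using hv
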